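/- (Left Join Decomposition.) Let R1 and R2 be relations over attribute sets U1 and U2, and F and G filters over U1 ∪ U2. Then σ_G(R1 ⟕_F R2) ≡ (R1 ⋈_{F ∧ G} R2) ⊎ (σ_{nullify_{U2∖U1}(G)} R1 ∖ π_{U1}(R1 ⋈_{F ∧ nullify_{U2∖U1}(G)} R2)). -/

import Mathlib

noncomputable section
open Classical

attribute [local instance 10] Classical.propDecidable

namespace RA

variable {A Δ : Type} [DecidableEq A] [DecidableEq Δ]

/-- Three-valued logic: true, false, unknown (error). -/
inductive TV where
  | tt | ff | unk
deriving DecidableEq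

/-- Kleene conjunction. -/
def TV.and : TV → TV → TV
  | .ff, _ => .ff
  | _, .ff => .ff
  | .tt, .tt => .tt
  | _, _ => .unk

/-- Kleene negation. -/
def TV.not : TV → TV
  | .tt => .ff
  | .ff => .tt
  | .unk => .unk

mutual
/-- Terms over attributes `A` and domain `Δ`: attributes, constants and conditionals. -/
inductive Term (A Δ : Type) where
  | attr : A → Term A Δ
  | const : Δ → Term A Δ
  | ite : Filter A Δ → Term A Δ → Term A Δ → Term A Δ

/-- RA filters: `isNull` on a (finite) set of terms, equality, conjunction, negation. -/
inductive Filter (A Δ : Type) where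
  | isNull : List (Term A Δ) → Filter A Δ
  | eq : Term A Δ → Term A Δ → Filter A Δ
  | and : Filter A Δ → Filter A Δ → Filter A Δ
  | not : Filter A Δ → Filter A Δ
end

/-- Disjunction: `F1 ∨ F2 = ¬(¬F1 ∧ ¬F2)`. -/
def Filter.or (F1 F2 : Filter A Δ) : Filter A Δ := .not ((Filter.not F1).and (Filter.not F2))

/-- The tautological filter ⊤ (`isNull` of the empty set of terms is always true). -/
def Filter.tru : Filter A Δ := .isNull []

/-- A tuple over a set of attributes: `none` marks attributes outside the set. -/
abbrev Tuple (A Δ : Type) := A → Option Δ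

mutual
/-- Evaluation of a term on a tuple (`null` is the distinguished null value of `Δ`). -/
def Term.eval (null : Δ) (t : Tuple A Δ) : Term A Δ → Δ
  | .attr a => (t a).getD null
  | .const c => c
  | .ite F v v' => if F.eval null t = TV.tt then v.eval null t else v'.eval null t

def Term.evalList (null : Δ) (t : Tuple A Δ) : List (Term A Δ) → List Δ
  | [] => []
  | v :: vs => v.eval null t :: Term.evalList null t vs

/-- Three-valued evaluation of a filter on a tuple. -/
def Filter.eval (null : Δ) (t : Tuple A Δ) : Filter A Δ → TV
  | .isNull V => if ∀ d ∈ Term.evalList null t V, d = null then .tt else .ff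
  | .eq v v' =>
      if v.eval null t = null ∨ v'.eval null t = null then .unk
      else if v.eval null t = v'.eval null t then .tt else .ff
  | .and F1 F2 => (F1.eval null t).and (F2.eval null t)
  | .not F => (F.eval null t).not
end

mutual
/-- Attributes occurring in a term. -/
def Term.attrs : Term A Δ → Finset A
  | .attr a => {a}
  | .const _ => ∅
  | .ite F v v' => F.attrs ∪ v.attrs ∪ v'.attrs

def Term.attrsList : List (Term A Δ) → Finset A
  | [] => ∅
  | v :: vs => v.attrs ∪ Term.attrsList vs

/-- Attributes occurring in a filter. -/
def Filter.attrs : Filter A Δ → Finset A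
  | .isNull V => Term.attrsList V
  | .eq v v' => v.attrs ∪ v'.attrs
  | .and F1 F2 => F1.attrs ∪ F2.attrs
  | .not F => F.attrs
end

/-- A term is over `U` if all its attributes are in `U`. -/
def Term.over (v : Term A Δ) (U : Finset A) : Prop := v.attrs ⊆ U

/-- A filter is over `U` if all its attributes are in `U`. -/
def Filter.over (F : Filter A Δ) (U : Finset A) : Prop := F.attrs ⊆ U

/-- A tuple is over `U` if its domain is exactly `U`. -/
def Tuple.isOver (t : Tuple A Δ) (U : Finset A) : Prop := ∀ a, (t a).isSome ↔ a ∈ U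

/-- A relation is a bag (multiset) of tuples. -/
abbrev Rel (A Δ : Type) := Multiset (Tuple A Δ)

/-- A relation is over `U` if all its tuples are. -/
def Rel.isOver (R : Rel A Δ) (U : Finset A) : Prop := ∀ t ∈ R, t.isOver U

/-- Selection σ_F. -/
def select (null : Δ) (F : Filter A Δ) (R : Rel A Δ) : Rel A Δ :=
  R.filter (fun t => F.eval null t = .tt)

/-- Restriction of a tuple to the attributes in `U`. -/
def Tuple.restrict (t : Tuple A Δ) (U : Finset A) : Tuple A Δ :=
  fun a => if a ∈ U then t a else none

/-- Projection π_U (bag semantics: multiplicities are added up). -/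
def proj (U : Finset A) (R : Rel A Δ) : Rel A Δ := R.map (·.restrict U)

/-- Bag difference: `(R1 ∖ R2)(t) = R1(t)` if `t ∉ R2` and `0` otherwise. -/
def bdiff (R1 R2 : Rel A Δ) : Rel A Δ := R1.filter (fun t => t ∉ R2)

/-- Compatibility of tuples: equal and non-null on the shared attributes. -/
def Compat (null : Δ) (t1 t2 : Tuple A Δ) : Prop :=
  ∀ a, (t1 a).isSome → (t2 a).isSome → (t1 a = t2 a ∧ t1 a ≠ some null)

/-- `t1 ⊕ t2`: the common extension of two (compatible) tuples. -/
def Tuple.merge (t1 t2 : Tuple A Δ) : Tuple A Δ :=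
  fun a => (t1 a).or (t2 a)

/-- Natural join. -/
def join (null : Δ) (R1 R2 : Rel A Δ) : Rel A Δ :=
  (R1.product R2).filterMap
    (fun p => if Compat null p.1 p.2 then some (p.1.merge p.2) else none)

/-- Natural join with a filter: `R1 ⋈_F R2 = σ_F (R1 ⋈ R2)`. -/
def joinF (null : Δ) (F : Filter A Δ) (R1 R2 : Rel A Δ) : Rel A Δ :=
  select null F (join null R1 R2)

/-- Padding of a tuple with `null` on the attributes of `V`. -/
def Tuple.pad (null : Δ) (V : Finset A) (t : Tuple A Δ) : Tuple A Δ :=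
  fun a => if a ∈ V then (t a).or (some null) else t a

/-- Outer union of `R1` over `U1` and `R2` over `U2`:
each relation is padded with nulls on the attributes missing from it. -/
def ounion (null : Δ) (U1 U2 : Finset A) (R1 R2 : Rel A Δ) : Rel A Δ :=
  R1.map (Tuple.pad null (U2 \ U1)) + R2.map (Tuple.pad null (U1 \ U2))

/-- Left join `R1 ⟕_F R2 = (R1 ⋈_F R2) ⊎ (R1 ∖ π_{U1}(R1 ⋈_F R2))`
for `R1` over `U1` and `R2` over `U2`. -/
def ljoin (null : Δ) (U1 U2 : Finset A) (F : Filter A Δ) (R1 R2 : Rel A Δ) : Rel A Δ :=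
  ounion null (U1 ∪ U2) U1 (joinF null F R1 R2) (bdiff R1 (proj U1 (joinF null F R1 R2)))

/-- Natural left join `R1 ⟕ R2 = R1 ⟕_⊤ R2`. -/
def nljoin (null : Δ) (U1 U2 : Finset A) (R1 R2 : Rel A Δ) : Rel A Δ :=
  ljoin null U1 U2 Filter.tru R1 R2

/-- Extension ν_{u↦v}. -/
def extend (null : Δ) (u : A) (v : Term A Δ) (R : Rel A Δ) : Rel A Δ :=
  R.map (fun t a => if a = u then some (v.eval null t) else t a)

/-- Duplicate elimination δ. -/
def dedup (R : Rel A Δ) : Rel A Δ := R.dedup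

/-- Extended renaming ρ^V_{{u/f(u) | u ∈ S}} at the level of tuples:
each attribute `u ∈ S` receives the value of the term `f u` (evaluated on the original
tuple) and the attributes of `V ∖ S` are projected away. -/
def renameFun (null : Δ) (V S : Finset A) (f : A → Term A Δ) (t : Tuple A Δ) : Tuple A Δ :=
  fun a => if a ∈ S then some ((f a).eval null t) else if a ∈ V then none else t a

/-- Extended renaming ρ^V_{{u/f(u) | u ∈ S}}. -/
def rename (null : Δ) (V S : Finset A) (f : A → Term A Δ) (R : Rel A Δ) : Rel A Δ :=
  R.map (renameFun null V S f)

/-- Renaming of the attribute `uold` into `unew` at the level of tuples. -/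
def renameAttrT (unew uold : A) (t : Tuple A Δ) : Tuple A Δ :=
  fun a => if a = unew then t uold else if a = uold then none else t a

/-- `R[unew/uold]`: the relation `R` with the attribute `uold` renamed to `unew`. -/
def renameAttr (unew uold : A) (R : Rel A Δ) : Rel A Δ := R.map (renameAttrT unew uold)

/-- `coalesce(v, v') = if(¬isNull(v), v, v')`. -/
def Term.coalesce (v v' : Term A Δ) : Term A Δ := .ite (.not (.isNull [v])) v v'

/-- The filter `⋀_{u ∈ K} ¬isNull(u)`. -/
def notNullAll (K : Finset A) : Filter A Δ :=
  K.toList.foldr (fun u acc => (Filter.not (.isNull [.attr u])).and acc) Filter.tru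

mutual
/-- `nullify_S`: replace every occurrence of an attribute from `S` by the constant null. -/
def Term.nullify (null : Δ) (S : Finset A) : Term A Δ → Term A Δ
  | .attr a => if a ∈ S then .const null else .attr a
  | .const c => .const c
  | .ite F v v' => .ite (F.nullify null S) (v.nullify null S) (v'.nullify null S)

def Term.nullifyList (null : Δ) (S : Finset A) : List (Term A Δ) → List (Term A Δ)
  | [] => []
  | v :: vs => v.nullify null S :: Term.nullifyList null S vs

/-- `nullify_S` on filters. -/
def Filter.nullify (null : Δ) (S : Finset A) : Filter A Δ → Filter A Δ
  | .isNull V => .isNull (Term.nullifyList null S V)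
  | .eq v v' => .eq (v.nullify null S) (v'.nullify null S)
  | .and F1 F2 => .and (F1.nullify null S) (F2.nullify null S)
  | .not F => .not (F.nullify null S)
end

/-- p-equivalence of filters over `U`: they are ⊤ on the same tuples over `U`. -/
def pequiv (null : Δ) (U : Finset A) (F1 F2 : Filter A Δ) : Prop :=
  ∀ t : Tuple A Δ, t.isOver U → (F1.eval null t = TV.tt ↔ F2.eval null t = TV.tt)

end RA

namespace RA

variable {A Δ : Type} [DecidableEq A] [DecidableEq Δ]

mutual
theorem Term.eval_congr {null : Δ} {s t : Tuple A Δ} (v : Term A Δ)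
    (h : ∀ a ∈ v.attrs, (s a).getD null = (t a).getD null) :
    v.eval null s = v.eval null t := by
  match v with
  | .attr a => simpa [Term.eval, Term.attrs] using h
  | .const c => simp [Term.eval]
  | .ite F v v' =>
    simp only [Term.attrs, Finset.mem_union] at h
    simp only [Term.eval]
    rw [Filter.eval_congr F fun a ha => h a (.inl (.inl ha)),
      Term.eval_congr v fun a ha => h a (.inl (.inr ha)),
      Term.eval_congr v' fun a ha => h a (.inr ha)]

theorem Term.evalList_congr {null : Δ} {s t : Tuple A Δ} (V : List (Term A Δ))
    (h : ∀ a ∈ Term.attrsList V, (s a).getD null = (t a).getD null) :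
    Term.evalList null s V = Term.evalList null t V := by
  match V with
  | [] => simp [Term.evalList]
  | v :: V =>
    simp only [Term.attrsList, Finset.mem_union] at h
    simp only [Term.evalList]
    rw [Term.eval_congr v fun a ha => h a (.inl ha),
      Term.evalList_congr V fun a ha => h a (.inr ha)]

/-- The value of a filter depends only on the attributes occurring in it, and does not
distinguish between an undefined attribute and a null one. -/
theorem Filter.eval_congr {null : Δ} {s t : Tuple A Δ} (F : Filter A Δ)
    (h : ∀ a ∈ F.attrs, (s a).getD null = (t a).getD null) :
    F.eval null s = F.eval null t := by
  match F with
  | .isNull V =>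
    simp only [Filter.attrs] at h
    simp only [Filter.eval]
    rw [Term.evalList_congr V h]
  | .eq v v' =>
    simp only [Filter.attrs, Finset.mem_union] at h
    simp only [Filter.eval]
    rw [Term.eval_congr v fun a ha => h a (.inl ha),
      Term.eval_congr v' fun a ha => h a (.inr ha)]
  | .and F F' =>
    simp only [Filter.attrs, Finset.mem_union] at h
    simp only [Filter.eval]
    rw [Filter.eval_congr F fun a ha => h a (.inl ha),
      Filter.eval_congr F' fun a ha => h a (.inr ha)]
  | .not F =>
    simp only [Filter.attrs] at h
    simp only [Filter.eval]
    rw [Filter.eval_congr F h]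
end

mutual
theorem Term.eval_nullify (null : Δ) (S : Finset A) (t : Tuple A Δ) (v : Term A Δ) :
    (v.nullify null S).eval null t = v.eval null (fun a => if a ∈ S then none else t a) := by
  match v with
  | .attr a => by_cases ha : a ∈ S <;> simp [Term.nullify, Term.eval, ha]
  | .const c => simp [Term.nullify, Term.eval]
  | .ite F v v' =>
    simp only [Term.nullify, Term.eval]
    rw [Filter.eval_nullify null S t F, Term.eval_nullify null S t v,
      Term.eval_nullify null S t v']

theorem Term.evalList_nullifyList (null : Δ) (S : Finset A) (t : Tuple A Δ)
    (V : List (Term A Δ)) :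
    Term.evalList null t (Term.nullifyList null S V) =
      Term.evalList null (fun a => if a ∈ S then none else t a) V := by
  match V with
  | [] => simp [Term.nullifyList, Term.evalList]
  | v :: V =>
    simp only [Term.nullifyList, Term.evalList]
    rw [Term.eval_nullify null S t v, Term.evalList_nullifyList null S t V]

/-- Evaluating a nullified filter amounts to evaluating the filter on the tuple from which
the nullified attributes have been erased. -/
theorem Filter.eval_nullify (null : Δ) (S : Finset A) (t : Tuple A Δ) (F : Filter A Δ) :
    (F.nullify null S).eval null t = F.eval null (fun a => if a ∈ S then none else t a) := by
  match F with
  | .isNull V =>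
    simp only [Filter.nullify, Filter.eval]
    rw [Term.evalList_nullifyList null S t V]
  | .eq v v' =>
    simp only [Filter.nullify, Filter.eval]
    rw [Term.eval_nullify null S t v, Term.eval_nullify null S t v']
  | .and F F' =>
    simp only [Filter.nullify, Filter.eval]
    rw [Filter.eval_nullify null S t F, Filter.eval_nullify null S t F']
  | .not F =>
    simp only [Filter.nullify, Filter.eval]
    rw [Filter.eval_nullify null S t F]
end

theorem TV.and_eq_tt {x y : TV} : x.and y = .tt ↔ x = .tt ∧ y = .tt := by
  cases x <;> cases y <;> simp [TV.and]

set_option linter.unusedSectionVars false in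
theorem Filter.eval_and_eq_tt {null : Δ} {t : Tuple A Δ} {F G : Filter A Δ} :
    (F.and G).eval null t = .tt ↔ F.eval null t = .tt ∧ G.eval null t = .tt := by
  rw [Filter.eval, TV.and_eq_tt]

set_option linter.unusedSectionVars false in
theorem select_select (null : Δ) (F G : Filter A Δ) (R : Rel A Δ) :
    select null G (select null F R) = select null (F.and G) R := by
  simp only [select, Multiset.filter_filter, Filter.eval_and_eq_tt, and_comm]

set_option linter.unusedSectionVars false in
theorem Tuple.pad_empty (null : Δ) : Tuple.pad null (∅ : Finset A) = id := by
  funext t a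
  simp [Tuple.pad]

theorem Filter.eval_pad {null : Δ} {U V : Finset A} {t : Tuple A Δ} (ht : t.isOver U)
    (hUV : Disjoint U V) (G : Filter A Δ) :
    G.eval null (t.pad null V) = (G.nullify null V).eval null t := by
  rw [Filter.eval_nullify]
  refine Filter.eval_congr G fun a _ => ?_
  by_cases ha : a ∈ V
  · have hn : t a = none := by
      rw [← Option.not_isSome_iff_eq_none, ht a]
      exact fun h => Finset.disjoint_left.mp hUV h ha
    simp [Tuple.pad, ha, hn]
  · simp [Tuple.pad, ha]

theorem Filter.eval_nullify_restrict {null : Δ} {U1 U2 : Finset A} {G : Filter A Δ}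
    (hG : G.over (U1 ∪ U2)) (t : Tuple A Δ) :
    (G.nullify null (U2 \ U1)).eval null (t.restrict U1) =
      (G.nullify null (U2 \ U1)).eval null t := by
  rw [Filter.eval_nullify, Filter.eval_nullify]
  refine Filter.eval_congr G fun a ha => ?_
  have := hG ha
  simp only [Finset.mem_union, Finset.mem_sdiff, Tuple.restrict] at this ⊢
  by_cases h1 : a ∈ U1 <;> simp_all

theorem mem_proj_select {null : Δ} {U : Finset A} {F : Filter A Δ} {R : Rel A Δ}
    {t : Tuple A Δ} :
    t ∈ proj U (select null F R) ↔ ∃ s ∈ R, F.eval null s = .tt ∧ s.restrict U = t := by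
  simp [proj, select, and_assoc]

theorem stmt15 (null : Δ) (U1 U2 : Finset A) (R1 R2 : Rel A Δ) (F G : Filter A Δ)
    (hR1 : R1.isOver U1) (hR2 : R2.isOver U2)
    (hF : F.over (U1 ∪ U2)) (hG : G.over (U1 ∪ U2)) :
    select null G (ljoin null U1 U2 F R1 R2)
      = ounion null (U1 ∪ U2) U1
          (joinF null (F.and G) R1 R2)
          (bdiff (select null (G.nullify null (U2 \ U1)) R1)
            (proj U1 (joinF null (F.and (G.nullify null (U2 \ U1))) R1 R2))) := by
  have hV : (U1 ∪ U2) \ U1 = U2 \ U1 := Finset.union_sdiff_left U1 U2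
  have hE : U1 \ (U1 ∪ U2) = ∅ := Finset.sdiff_eq_empty_iff_subset.mpr Finset.subset_union_left
  simp only [ljoin, ounion, hV, hE, Tuple.pad_empty, Multiset.map_id, joinF]
  rw [← select_select null F G]
  refine (Multiset.filter_add _ _ _).trans (congrArg₂ _ rfl ?_)
  refine (Multiset.filter_map _ _ _).trans (congrArg _ ?_)
  refine (Multiset.filter_filter _ _ _).trans (Eq.trans ?_ (Multiset.filter_filter _ _ _).symm)
  refine Multiset.filter_congr fun t ht => ?_
  simp only [Function.comp_apply, Filter.eval_pad (hR1 t ht) Finset.disjoint_sdiff]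
  rw [and_comm]
  refine and_congr_left fun hGt => not_congr ?_
  simp only [mem_proj_select, Filter.eval_and_eq_tt]
  refine exists_congr fun s => and_congr_right fun _ => and_congr_left fun hs => ?_
  rw [← Filter.eval_nullify_restrict hG s, hs]
  exact (and_iff_left hGt).symm

end RA
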